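/- Let A = ⊕_{i∈ℤ} A_i be a ℤ-graded finitely generated normal integral domain over ℂ of Krull dimension 2 with A_0 of Krull dimension 1 and A_1 ≠ 0. Let d be the minimal positive integer such that A_{d+n} = A_d·A_n for every n ≥ 0, and let v ∈ A_d be an element generating A_d as an A_0-module. Let δ = ∂_k + ... + ∂_l be a nonzero locally nilpotent ℂ-derivation of A, where l ≥ k ≥ 0 and each ∂_i is a derivation homogeneous of degree i. Then ker δ = ℂ[v, v⁻¹] ∩ A; that is, ker δ consists exactly of those elements of A whose image in the fraction field Frac(A) lies in the ℂ-subalgebra generated by v and v⁻¹. In particular, δ restricted to A_0 is nonzero. -/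

import Mathlib

/-- A `ℂ`-derivation `D` of a commutative `ℂ`-algebra `A` is locally nilpotent if for every
`f ∈ A` there is `n` with `D^[n] f = 0`. -/
def Derivation.IsLocallyNilpotent {A : Type*} [CommRing A] [Algebra ℂ A]
    (D : Derivation ℂ A A) : Prop :=
  ∀ f : A, ∃ n : ℕ, (⇑D)^[n] f = 0

theorem Derivation.iterate_apply_mul {R A : Type*} [CommRing R] [CommRing A] [Algebra R A]
    (D : Derivation R A A) (n : ℕ) (a b : A) :
    D^[n] (a * b) =
      ∑ ij ∈ Finset.HasAntidiagonal.antidiagonal n, n.choose ij.1 • (D^[ij.1] a * D^[ij.2] b) := by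
  induction n with
  | zero => simp
  | succ n ih =>
    rw [Finset.sum_antidiagonal_choose_succ_nsmul (M := A) (fun i j => D^[i] a * D^[j] b) n]
    simp only [Function.iterate_succ_apply', ih, map_sum, map_nsmul, Derivation.leibniz,
      smul_eq_mul, smul_add, Finset.sum_add_distrib, add_right_inj]
    refine Finset.sum_congr rfl fun ⟨i, j⟩ hij ↦ ?_
    rw [n.choose_symm_of_eq_add (Finset.HasAntidiagonal.mem_antidiagonal.1 hij).symm, mul_comm]

theorem Derivation.iterate_apply_eq_zero_of_le {R A : Type*} [CommRing R] [CommRing A]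
    [Algebra R A] (D : Derivation R A A) {a : A} {m n : ℕ} (h : D^[m] a = 0) (hmn : m ≤ n) :
    D^[n] a = 0 := by
  obtain ⟨k, rfl⟩ := Nat.exists_eq_add_of_le' hmn
  rw [Function.iterate_add_apply, h, iterate_map_zero]

/-- Additivity of the degree function of a locally nilpotent derivation. -/
theorem Derivation.iterate_add_apply_mul {R A : Type*} [CommRing R] [CommRing A] [Algebra R A]
    (D : Derivation R A A) {a b : A} {m n : ℕ} (ha : D^[m + 1] a = 0) (hb : D^[n + 1] b = 0) :
    D^[m + n] (a * b) = (m + n).choose m • (D^[m] a * D^[n] b) := by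
  rw [D.iterate_apply_mul, Finset.sum_eq_single (m, n)]
  · rintro ⟨i, j⟩ hij hne
    rw [Finset.HasAntidiagonal.mem_antidiagonal] at hij
    rcases lt_trichotomy i m with h | h | h
    · rw [D.iterate_apply_eq_zero_of_le (n := j) hb (by grind), mul_zero, smul_zero]
    · exact absurd (by grind) hne
    · rw [D.iterate_apply_eq_zero_of_le (n := i) ha h, zero_mul, smul_zero]
  · simp

theorem Derivation.IsLocallyNilpotent.exists_iterate_ne_zero {A : Type*} [CommRing A]
    [Algebra ℂ A] {D : Derivation ℂ A A} (hD : D.IsLocallyNilpotent) {a : A} (ha : a ≠ 0) :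
    ∃ n, D^[n] a ≠ 0 ∧ D^[n + 1] a = 0 := by
  classical
  have h0 : Nat.find (hD a) ≠ 0 := fun h ↦ ha <| by simpa [h] using Nat.find_spec (hD a)
  obtain ⟨n, hn⟩ := Nat.exists_eq_succ_of_ne_zero h0
  exact ⟨n, Nat.find_min (hD a) (by omega), by simpa [hn] using Nat.find_spec (hD a)⟩

theorem Derivation.IsLocallyNilpotent.apply_eq_zero_of_dvd {A : Type*} [CommRing A] [IsDomain A]
    [Algebra ℂ A] {D : Derivation ℂ A A} (hD : D.IsLocallyNilpotent) {f : A} (hf : f ∣ D f) :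
    D f = 0 := by
  by_contra hne
  obtain ⟨g, hg⟩ := hf
  have : CharZero A := charZero_of_injective_algebraMap (algebraMap ℂ A).injective
  obtain ⟨m, hm, hm'⟩ := hD.exists_iterate_ne_zero (a := f) (by rintro rfl; simp at hne)
  obtain ⟨n, hn, hn'⟩ := hD.exists_iterate_ne_zero (a := g) (by rintro rfl; simp [hg] at hne)
  have h := D.iterate_add_apply_mul hm' hn'
  rw [← hg, ← Function.iterate_succ_apply,
    D.iterate_apply_eq_zero_of_le hm' (by omega), eq_comm, smul_eq_zero] at h
  exact h.elim (Nat.choose_pos (Nat.le_add_right m n)).ne' (mul_ne_zero hm hn)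

theorem Derivation.eq_zero_of_isAlgebraic {R A : Type*} [CommRing R] [CommRing A] [IsDomain A]
    [CharZero A] [Algebra R A] [FaithfulSMul R A] [Algebra.IsAlgebraic R A]
    (D : Derivation R A A) : D = 0 := by
  have key (n : ℕ) : ∀ p : Polynomial R, p.natDegree = n → p ≠ 0 →
      ∀ x : A, Polynomial.aeval x p = 0 → D x = 0 := by
    induction n using Nat.strong_induction_on with
    | _ n ih =>
      intro p hpn hp x hx
      by_contra hDx
      have h := D.map_aeval p x
      rw [hx, map_zero, eq_comm, smul_eq_mul, mul_eq_zero, or_iff_left hDx] at h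
      have : CharZero R := (algebraMap R A).charZero
      have : IsDomain R := (FaithfulSMul.algebraMap_injective R A).isDomain
      have hn : p.natDegree ≠ 0 := fun h0 ↦ by
        rw [Polynomial.eq_C_of_natDegree_eq_zero h0, Polynomial.aeval_C,
          FaithfulSMul.algebraMap_eq_zero_iff] at hx
        exact hp (by rw [Polynomial.eq_C_of_natDegree_eq_zero h0, hx, map_zero])
      refine hDx (ih _ ?_ p.derivative rfl ?_ x h)
      · exact hpn ▸ Polynomial.natDegree_derivative_lt hn
      · exact fun h0 ↦ hn (Polynomial.derivative_eq_zero.1 h0)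
  ext x
  obtain ⟨p, hp, hx⟩ := Algebra.IsAlgebraic.isAlgebraic (R := R) x
  exact key _ p rfl hp x hx

theorem Derivation.eq_zero_of_isAlgebraic_adjoin {R A : Type*} [CommRing R] [CommRing A]
    [IsDomain A] [CharZero A] [Algebra R A] (D : Derivation R A A) (s : Set A)
    [Algebra.IsAlgebraic (Algebra.adjoin R s) A] (hs : ∀ x ∈ s, D x = 0) : D = 0 := by
  have h0 : ∀ x ∈ Algebra.adjoin R s, D x = 0 :=
    fun x hx ↦ D.eqOn_adjoin (D2 := 0) (fun y hy ↦ by simpa using hs y hy) hx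
  let E : Derivation (Algebra.adjoin R s) A A := Derivation.mk'
    { toFun := D
      map_add' := map_add D
      map_smul' := fun r x ↦ by simp [Algebra.smul_def, h0 r r.2] } (by simp)
  ext x
  exact DFunLike.congr_fun E.eq_zero_of_isAlgebraic x

theorem ringKrullDim_le_of_hasGoingUp {R S : Type*} [CommRing R] [CommRing S] [Algebra R S]
    [Algebra.HasGoingUp R S] (h : Function.Surjective (PrimeSpectrum.comap (algebraMap R S))) :
    ringKrullDim R ≤ ringKrullDim S := by
  refine iSup_le fun l ↦ ?_
  obtain ⟨P, hP⟩ := h l.head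
  have : P.asIdeal.LiesOver l.head.asIdeal := ⟨by rw [← hP]; rfl⟩
  obtain ⟨L, hL, -⟩ := Ideal.exists_ltSeries_of_hasGoingUp l P.asIdeal
  exact hL ▸ le_iSup (fun p : LTSeries (PrimeSpectrum S) ↦ (p.length : WithBot ℕ∞)) L

open Cardinal in
theorem Algebra.trdeg_le_of_ringKrullDim_le {K A : Type*} [Field K] [CommRing A] [IsDomain A]
    [Algebra K A] [Algebra.FiniteType K A] {n : ℕ} (h : ringKrullDim A ≤ n) :
    Algebra.trdeg K A ≤ n := by
  obtain ⟨s, g, hg, hint⟩ := exists_integral_inj_algHom_of_fg K A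
  algebraize [g.toRingHom]
  have : FaithfulSMul (MvPolynomial (Fin s) K) A := (faithfulSMul_iff_algebraMap_injective _ _).2 hg
  have : Algebra.IsIntegral (MvPolynomial (Fin s) K) A := ⟨hint⟩
  have hb := (IsTranscendenceBasis.mvPolynomial (Fin s) K).algebraMap_comp (A := A)
  have hs := hb.lift_cardinalMk_eq_trdeg
  have hle : ringKrullDim (MvPolynomial (Fin s) K) ≤ n :=
    (ringKrullDim_le_of_hasGoingUp
      (Algebra.IsIntegral.comap_surjective _ A)).trans h
  rw [MvPolynomial.ringKrullDim_of_isNoetherianRing, ringKrullDim_eq_zero_of_field, zero_add,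
    Nat.card_fin] at hle
  have hsn : s ≤ n := by exact_mod_cast hle
  simp at hs
  rw [← hs]
  exact_mod_cast hsn

theorem IsAlgebraic.exists_algebraMap_eq {K A : Type*} [Field K] [IsAlgClosed K] [CommRing A]
    [IsDomain A] [Algebra K A] {a : A} (ha : IsAlgebraic K a) : ∃ c : K, algebraMap K A c = a :=
  minpoly.mem_range_of_degree_eq_one K a <|
    IsAlgClosed.degree_eq_one_of_irreducible K (minpoly.irreducible ha.isIntegral)

theorem Derivation.sum_apply {R A ι : Type*} [CommRing R] [CommRing A] [Algebra R A]
    (s : Finset ι) (D : ι → Derivation R A A) (x : A) : (∑ i ∈ s, D i) x = ∑ i ∈ s, D i x := by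
  classical
  induction s using Finset.induction_on with
  | empty => simp
  | insert i s hi ih => simp [Finset.sum_insert hi, ih]

theorem algebraMap_mem_adjoin_pair_inv_iff {K A L : Type*} [CommRing K] [CommRing A] [Field L]
    [Algebra K A] [Algebra A L] [Algebra K L] [IsScalarTower K A L] [FaithfulSMul A L]
    {v : A} (hv : v ≠ 0) {x : A} :
    algebraMap A L x ∈ Algebra.adjoin K {algebraMap A L v, (algebraMap A L v)⁻¹} ↔
      ∃ N : ℕ, v ^ N * x ∈ Algebra.adjoin K {v} := by
  have hv' : algebraMap A L v ≠ 0 := by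
    simpa using (FaithfulSMul.algebraMap_injective A L).ne hv
  have hself := Algebra.self_mem_adjoin_singleton K v
  constructor
  · intro hx
    have clear_denom : ∀ w ∈ Algebra.adjoin K {algebraMap A L v, (algebraMap A L v)⁻¹},
        ∃ N : ℕ, ∃ z ∈ Algebra.adjoin K {v}, w * algebraMap A L v ^ N = algebraMap A L z := by
      intro w hw
      induction hw using Algebra.adjoin_induction with
      | mem y hy =>
        rcases hy with rfl | rfl
        · exact ⟨0, v, hself, by simp⟩
        · exact ⟨1, 1, one_mem _, by simp [hv']⟩
      | algebraMap c =>
        exact ⟨0, algebraMap K A c, algebraMap_mem _ c, by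
          simp [← IsScalarTower.algebraMap_apply]⟩
      | add y y' _ _ hy hy' =>
        obtain ⟨N, z, hz, h⟩ := hy
        obtain ⟨N', z', hz', h'⟩ := hy'
        refine ⟨N + N', z * v ^ N' + z' * v ^ N, add_mem (mul_mem hz (pow_mem hself _))
          (mul_mem hz' (pow_mem hself _)), ?_⟩
        rw [map_add, map_mul, map_mul, ← h, ← h', map_pow, map_pow]
        ring
      | mul y y' _ _ hy hy' =>
        obtain ⟨N, z, hz, h⟩ := hy
        obtain ⟨N', z', hz', h'⟩ := hy'
        refine ⟨N + N', z * z', mul_mem hz hz', ?_⟩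
        rw [map_mul, ← h, ← h']
        ring
    obtain ⟨N, z, hz, hzx⟩ := clear_denom _ hx
    refine ⟨N, ?_⟩
    rwa [mul_comm, FaithfulSMul.algebraMap_injective A L (a₁ := x * v ^ N) (by simpa using hzx)]
  · rintro ⟨N, hN⟩
    have hle : (Algebra.adjoin K {v}).map (IsScalarTower.toAlgHom K A L) ≤
        Algebra.adjoin K {algebraMap A L v, (algebraMap A L v)⁻¹} := by
      rw [AlgHom.map_adjoin]
      exact Algebra.adjoin_mono (by simp)
    have hinv : (algebraMap A L v)⁻¹ ∈
        Algebra.adjoin K {algebraMap A L v, (algebraMap A L v)⁻¹} :=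
      Algebra.subset_adjoin (by simp)
    have hx : algebraMap A L (v ^ N * x) ∈
        Algebra.adjoin K {algebraMap A L v, (algebraMap A L v)⁻¹} :=
      hle (Subalgebra.mem_map.2 ⟨_, hN, rfl⟩)
    have h := mul_mem (pow_mem hinv N) hx
    rwa [map_mul, map_pow, ← mul_assoc, ← mul_pow, inv_mul_cancel₀ hv', one_pow, one_mul] at h

section Graded

open DirectSum

theorem transcendental_of_mem_graded {K A : Type*} [Field K] [CommRing A] [IsDomain A]
    [Algebra K A] (𝒜 : ℤ → Submodule K A) [GradedAlgebra 𝒜] (S : Subalgebra K A)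
    (hS : ∀ x ∈ S, x ∈ 𝒜 0) {d : ℤ} (hd : d ≠ 0) {v : A} (hv : v ∈ 𝒜 d) (hv0 : v ≠ 0) :
    Transcendental S v := by
  rw [transcendental_iff]
  intro p hp
  ext j
  have hmem (i : ℕ) : (p.coeff i : A) * v ^ i ∈ 𝒜 (i * d) := by
    simpa using SetLike.mul_mem_graded (hS _ (p.coeff i).2) (SetLike.pow_mem_graded i hv)
  rw [Polynomial.aeval_eq_sum_range] at hp
  have h := congrArg (GradedAlgebra.proj 𝒜 (j * d)) hp
  simp only [map_sum, map_zero, GradedAlgebra.proj_apply, Subalgebra.smul_def, smul_eq_mul] at h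
  by_cases hj : j ∈ Finset.range (p.natDegree + 1)
  · rw [Finset.sum_eq_single_of_mem j hj, decompose_of_mem_same 𝒜 (hmem j)] at h
    · simpa [hv0] using h
    · intro i _ hij
      exact decompose_of_mem_ne 𝒜 (hmem i) fun h ↦ hij (by simpa [hd] using h)
  · simp [Polynomial.coeff_eq_zero_of_natDegree_lt (by simpa using hj : p.natDegree < j)]

theorem Derivation.eq_zero_of_transcendental {K A : Type*} [Field K] [CharZero K] [CommRing A]
    [IsDomain A] [Algebra K A] [Algebra.FiniteType K A] (hdim : ringKrullDim A = 2)
    (D : Derivation K A A) {a v : A} (ha : Transcendental K a)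
    (hv : Transcendental (Algebra.adjoin K {a}) v) (hDa : D a = 0) (hDv : D v = 0) : D = 0 := by
  have hind : AlgebraicIndependent K (fun o : Option Unit ↦ o.elim v fun _ ↦ a) := by
    rw [AlgebraicIndependent.option_iff, algebraicIndependent_unique_type_iff, Set.range_const]
    exact ⟨ha, hv⟩
  have htr : Algebra.trdeg K A ≤ (2 : ℕ) := Algebra.trdeg_le_of_ringKrullDim_le hdim.le
  have hb := hind.isTranscendenceBasis_of_lift_trdeg_le_of_finite <| by
    simpa [one_add_one_eq_two] using htr
  have := hb.isAlgebraic
  have : CharZero A := charZero_of_injective_algebraMap (algebraMap K A).injective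
  refine D.eq_zero_of_isAlgebraic_adjoin (Set.range fun o : Option Unit ↦ o.elim v fun _ ↦ a) ?_
  rintro _ ⟨_ | _, rfl⟩
  exacts [hDv, hDa]

variable {K A : Type*} [Field K] [CommRing A] [Algebra K A] (𝒜 : ℤ → Submodule K A)
  [GradedAlgebra 𝒜]

theorem exists_eq_mul_of_mem_graded_add {d : ℤ} {v : A}
    (hvgen : ∀ a ∈ 𝒜 d, ∃ a₀ ∈ 𝒜 0, a = a₀ * v) {n : ℤ} (hdmul : 𝒜 (d + n) = 𝒜 d * 𝒜 n)
    {a : A} (ha : a ∈ 𝒜 (d + n)) : ∃ b ∈ 𝒜 n, a = v * b := by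
  rw [hdmul] at ha
  induction ha using Submodule.mul_induction_on' with
  | mem_mul_mem x hx y hy =>
    obtain ⟨a₀, ha₀, rfl⟩ := hvgen x hx
    exact ⟨a₀ * y, by simpa using SetLike.mul_mem_graded ha₀ hy, by ring⟩
  | add x _ y _ hx hy =>
    obtain ⟨b, hb, rfl⟩ := hx
    obtain ⟨c, hc, rfl⟩ := hy
    exact ⟨b + c, add_mem hb hc, by ring⟩

omit [GradedAlgebra 𝒜] in
theorem exists_eq_pow_mul_of_mem_graded {d : ℤ} (hd : 0 ≤ d) {v : A}
    (hdiv : ∀ n : ℤ, 0 ≤ n → ∀ a ∈ 𝒜 (d + n), ∃ b ∈ 𝒜 n, a = v * b) (q : ℕ) {n : ℤ}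
    (hn : 0 ≤ n) {a : A} (ha : a ∈ 𝒜 (q * d + n)) : ∃ b ∈ 𝒜 n, a = v ^ q * b := by
  induction q generalizing a with
  | zero => exact ⟨a, by simpa using ha, by simp⟩
  | succ q ih =>
    obtain ⟨b, hb, rfl⟩ := hdiv (q * d + n) (by positivity) a (by
      convert ha using 2; push_cast; ring)
    obtain ⟨c, hc, rfl⟩ := ih hb
    exact ⟨c, hc, by ring⟩

theorem Derivation.eq_zero_of_pow [IsDomain A] [CharZero A] (D : Derivation K A A) {a : A} {n : ℕ}
    (hn : n ≠ 0) (h : D (a ^ n) = 0) : D a = 0 := by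
  rcases eq_or_ne a 0 with rfl | ha
  · simp
  · simpa [Derivation.leibniz_pow, hn, ha] using h

theorem Derivation.eq_zero_of_mul_left [IsDomain A] (D : Derivation K A A) {a b : A}
    (ha : a ≠ 0) (hDa : D a = 0) (h : D (a * b) = 0) : D b = 0 := by
  simpa [hDa, ha] using h

theorem Derivation.eq_zero_of_graded_zero [IsDomain A] [CharZero A] (D : Derivation K A A)
    {d : ℤ} (hd : 0 < d) {v : A} (hv : v ∈ 𝒜 d) (hv0 : v ≠ 0)
    (hdiv : ∀ n : ℤ, 0 ≤ n → ∀ a ∈ 𝒜 (d + n), ∃ b ∈ 𝒜 n, a = v * b)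
    (hDv : D v = 0) (hD : ∀ a ∈ 𝒜 0, D a = 0) : D = 0 := by
  lift d to ℕ using hd.le with e
  have he : e ≠ 0 := by omega
  have hhom (i : ℤ) (a : A) (ha : a ∈ 𝒜 i) : D a = 0 := by
    have hpow : a ^ e ∈ 𝒜 (e * i) := by simpa using SetLike.pow_mem_graded e ha
    refine D.eq_zero_of_pow he ?_
    obtain ⟨m, rfl | rfl⟩ := i.eq_nat_or_neg
    · obtain ⟨b, hb, h⟩ := exists_eq_pow_mul_of_mem_graded 𝒜 hd.le hdiv m le_rfl
        (a := a ^ e) (by convert hpow using 2; ring)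
      simp [h, hD b hb, hDv, Derivation.leibniz_pow]
    · refine D.eq_zero_of_mul_left (a := v ^ m) (by positivity)
        (by simp [hDv, Derivation.leibniz_pow]) (hD _ ?_)
      convert SetLike.mul_mem_graded (SetLike.pow_mem_graded m hv) hpow using 2
      simp [mul_comm]
  ext x
  induction x using Decomposition.inductionOn 𝒜 with
  | zero => simp
  | homogeneous a => exact hhom _ _ a.2
  | add a b ha hb => simp_all

theorem exists_eq_algebraMap_mul_pow_of_mem_graded [IsDomain A] {d : ℤ}
    (hd : 0 < d)
    (hdmin : ∀ d' : ℤ, 0 < d' → (∀ n : ℤ, 0 ≤ n → 𝒜 (d' + n) = 𝒜 d' * 𝒜 n) → d ≤ d')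
    {v : A} (hv0 : v ≠ 0)
    (hdiv : ∀ n : ℤ, 0 ≤ n → ∀ a ∈ 𝒜 (d + n), ∃ b ∈ 𝒜 n, a = v * b)
    (D : Derivation K A A) (hDv : D v = 0)
    (hD : ∀ a ∈ 𝒜 0, D a = 0 → ∃ c : K, algebraMap K A c = a)
    {n : ℤ} (hn : 0 ≤ n) {x : A} (hx : x ∈ 𝒜 n) (hDx : D x = 0) :
    ∃ (c : K) (q : ℕ), x = algebraMap K A c * v ^ q := by
  rcases eq_or_ne x 0 with rfl | hx0
  · exact ⟨0, 0, by simp⟩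
  have hDpow (q : ℕ) : D (v ^ q) = 0 := by simp [hDv, Derivation.leibniz_pow]
  lift n / d to ℕ using Int.ediv_nonneg hn hd.le with q hq
  have hr0 : 0 ≤ n % d := Int.emod_nonneg n hd.ne'
  have hrd : n % d < d := Int.emod_lt_of_pos n hd
  obtain ⟨y, hy, rfl⟩ := exists_eq_pow_mul_of_mem_graded 𝒜 hd.le hdiv q hr0 (a := x) <| by
    rwa [hq, Int.ediv_mul_add_emod]
  have hy0 : y ≠ 0 := right_ne_zero_of_mul hx0
  have hDy : D y = 0 := D.eq_zero_of_mul_left (pow_ne_zero q hv0) (hDpow q) hDx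
  generalize n % d = r at hr0 hrd hy
  lift r to ℕ using hr0
  lift d to ℕ using hd.le with e
  obtain ⟨f, rfl⟩ : ∃ f, e = f + 1 := Nat.exists_eq_succ_of_ne_zero (by omega)
  obtain ⟨b, hb, hyb⟩ := exists_eq_pow_mul_of_mem_graded 𝒜 hd.le hdiv r le_rfl
    (a := y ^ (f + 1)) <| by
      convert SetLike.pow_mem_graded (f + 1) hy using 2
      simp [mul_comm]
  obtain ⟨c, rfl⟩ := hD b hb <| D.eq_zero_of_mul_left (pow_ne_zero r hv0) (hDpow r) <| by
    simp [← hyb, hDy, Derivation.leibniz_pow]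
  rcases r.eq_zero_or_pos with rfl | hrpos
  · obtain ⟨c', rfl⟩ := hD y (by simpa using hy) hDy
    exact ⟨c', q, mul_comm _ _⟩
  refine absurd (hdmin r (by omega) fun m hm ↦ le_antisymm (fun a ha ↦ ?_) ?_) (by omega)
  · have hc : c ≠ 0 := by
      rintro rfl
      simp [hy0] at hyb
    obtain ⟨b', hb', h⟩ := exists_eq_pow_mul_of_mem_graded 𝒜 hd.le hdiv r hm
      (a := y ^ f * a) <| by
        convert SetLike.mul_mem_graded (SetLike.pow_mem_graded f hy) ha using 2
        simp
        ring
    have : a = y * (c⁻¹ • b') := by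
      refine mul_left_cancel₀ (pow_ne_zero f hy0) ?_
      rw [← mul_assoc, ← pow_succ, hyb, h, Algebra.smul_def, mul_assoc,
        ← mul_assoc (algebraMap K A c),
        ← map_mul, mul_inv_cancel₀ hc, map_one, one_mul]
    rw [this]
    exact Submodule.mul_mem_mul hy ((𝒜 m).smul_mem _ hb')
  · exact Submodule.mul_le.2 fun s hs t ht ↦ SetLike.mul_mem_graded hs ht

theorem Derivation.decompose_apply_of_homogeneous (D : Derivation K A A) {i : ℤ}
    (hD : ∀ n : ℤ, ∀ a ∈ 𝒜 n, D a ∈ 𝒜 (n + i)) (x : A) (n : ℤ) :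
    (decompose 𝒜 (D x) (n + i) : A) = D (decompose 𝒜 x n) := by
  induction x using Decomposition.inductionOn 𝒜 with
  | zero => simp
  | @homogeneous m a =>
    rcases eq_or_ne m n with rfl | hmn
    · rw [decompose_of_mem_same 𝒜 (hD m a a.2), decompose_of_mem_same 𝒜 a.2]
    · rw [decompose_of_mem_ne 𝒜 (hD m a a.2) (by simpa using hmn),
        decompose_of_mem_ne 𝒜 a.2 hmn, map_zero]
  | add a b ha hb => simp [ha, hb]

theorem Derivation.apply_top_component_eq_zero {s : Finset ℤ} {Dc : ℤ → Derivation K A A}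
    (hhomc : ∀ i : ℤ, ∀ n : ℤ, ∀ a ∈ 𝒜 n, Dc i a ∈ 𝒜 (n + i)) {l : ℤ} (hl : l ∈ s)
    (hmax : ∀ i ∈ s, l < i → Dc i = 0) {x : A} (hx : (∑ i ∈ s, Dc i) x = 0) {t : ℤ}
    (ht : ∀ j, t < j → (decompose 𝒜 x j : A) = 0) : Dc l (decompose 𝒜 x t) = 0 := by
  have h := congrArg (GradedAlgebra.proj 𝒜 (t + l)) hx
  simp only [Derivation.sum_apply, map_sum, map_zero, GradedAlgebra.proj_apply] at h
  rw [Finset.sum_eq_single_of_mem l hl,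
    (Dc l).decompose_apply_of_homogeneous 𝒜 (hhomc l)] at h
  · exact h
  · intro i hi hil
    rcases lt_or_gt_of_ne hil with hlt | hgt
    · rw [show t + l = (t + l - i) + i by ring,
        (Dc i).decompose_apply_of_homogeneous 𝒜 (hhomc i), ht _ (by omega), map_zero]
    · simp [hmax i hi hgt]

end Graded

/-- Let `A = ⊕_{i ∈ ℤ} A_i` be a `ℤ`-graded finitely generated normal domain
over `ℂ` of Krull dimension `2`, with `A_0` of Krull dimension `1` and `A_1 ≠ 0`.  Let `d` be
the minimal positive integer with `A_{d+n} = A_d · A_n` for all `n ≥ 0` and let `v ∈ A_d`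
generate `A_d` as an `A_0`-module.  If `δ = ∂_k + ⋯ + ∂_l` is a nonzero locally nilpotent
`ℂ`-derivation of `A` with `l ≥ k ≥ 0` and `∂_i` homogeneous of degree `i`, then
`ker δ = ℂ[v, v⁻¹] ∩ A` (inside `Frac A`); in particular `δ` does not vanish on `A_0`. -/
theorem kernel_of_nonnegative_lnd_eq_laurent_intersection
    {A : Type*} [CommRing A] [IsDomain A] [Algebra ℂ A] [Algebra.FiniteType ℂ A]
    [IsIntegrallyClosed A]
    (𝒜 : ℤ → Submodule ℂ A) [GradedAlgebra 𝒜]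
    (hdim : ringKrullDim A = 2)
    (hdim0 : ringKrullDim (SetLike.GradeZero.subalgebra 𝒜) = 1)
    (hA1 : 𝒜 1 ≠ ⊥)
    (d : ℤ) (hd : 0 < d)
    (hdmul : ∀ n : ℤ, 0 ≤ n → 𝒜 (d + n) = 𝒜 d * 𝒜 n)
    (hdmin : ∀ d' : ℤ, 0 < d' → (∀ n : ℤ, 0 ≤ n → 𝒜 (d' + n) = 𝒜 d' * 𝒜 n) → d ≤ d')
    (v : A) (hv : v ∈ 𝒜 d) (hvne : v ≠ 0)
    (hvgen : ∀ a ∈ 𝒜 d, ∃ a₀ ∈ 𝒜 0, a = a₀ * v)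
    (k l : ℤ) (hk : 0 ≤ k) (hkl : k ≤ l)
    (Dc : ℤ → Derivation ℂ A A)
    (hhomc : ∀ i : ℤ, ∀ n : ℤ, ∀ a ∈ 𝒜 n, Dc i a ∈ 𝒜 (n + i))
    (δ : Derivation ℂ A A) (hδsum : δ = ∑ i ∈ Finset.Icc k l, Dc i)
    (hδne : δ ≠ 0) (hδ : δ.IsLocallyNilpotent) :
    (∀ x : A, δ x = 0 ↔ algebraMap A (FractionRing A) x ∈
      Algebra.adjoin ℂ {algebraMap A (FractionRing A) v, (algebraMap A (FractionRing A) v)⁻¹}) ∧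
    ∃ a ∈ 𝒜 0, δ a ≠ 0 := by
  classical
  have : CharZero A := charZero_of_injective_algebraMap (algebraMap ℂ A).injective
  have hdiv (n : ℤ) (hn : 0 ≤ n) (a : A) (ha : a ∈ 𝒜 (d + n)) : ∃ b ∈ 𝒜 n, a = v * b :=
    exists_eq_mul_of_mem_graded_add 𝒜 hvgen (hdmul n hn) ha
  have hδv : δ v = 0 := by
    refine hδ.apply_eq_zero_of_dvd ?_
    rw [hδsum, Derivation.sum_apply]
    refine Finset.dvd_sum fun i hi ↦ ?_
    obtain ⟨b, -, hb⟩ := hdiv i (hk.trans (Finset.mem_Icc.1 hi).1) _ (hhomc i d v hv)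
    exact ⟨b, hb⟩
  have hδpow (n : ℕ) : δ (v ^ n) = 0 := by simp [hδv, Derivation.leibniz_pow]
  obtain ⟨m, hm, hmax⟩ : ∃ m ∈ (Finset.Icc k l).filter (Dc · ≠ 0),
      ∀ i ∈ (Finset.Icc k l).filter (Dc · ≠ 0), i ≤ m := by
    refine Finset.exists_max_image _ id ?_
    by_contra hempty
    rw [Finset.not_nonempty_iff_eq_empty, Finset.filter_eq_empty_iff] at hempty
    exact hδne (hδsum.trans (Finset.sum_eq_zero fun i hi ↦ not_not.1 (hempty hi)))
  rw [Finset.mem_filter] at hm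
  have htop {x : A} (hx : δ x = 0) {t : ℤ} (ht : ∀ j, t < j → (DirectSum.decompose 𝒜 x j : A) = 0) :
      Dc m (DirectSum.decompose 𝒜 x t) = 0 := by
    refine Derivation.apply_top_component_eq_zero 𝒜 hhomc hm.1 (fun i hi hmi ↦ ?_) (hδsum ▸ hx) ht
    by_contra hi0
    exact hmi.not_ge (hmax i (Finset.mem_filter.2 ⟨hi, hi0⟩))
  have hDv : Dc m v = 0 := by
    simpa [DirectSum.decompose_of_mem_same 𝒜 hv] using
      htop hδv (t := d) fun j hj ↦ DirectSum.decompose_of_mem_ne 𝒜 hv hj.ne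
  have hD0 (a : A) (ha : a ∈ 𝒜 0) (hDa : Dc m a = 0) : ∃ c : ℂ, algebraMap ℂ A c = a := by
    refine IsAlgebraic.exists_algebraMap_eq (not_not.1 fun htr ↦ hm.2 ?_)
    refine (Dc m).eq_zero_of_transcendental hdim htr ?_ hDa hDv
    refine transcendental_of_mem_graded 𝒜 _ (fun x hx ↦ ?_) hd.ne' hv hvne
    exact Algebra.adjoin_le (S := SetLike.GradeZero.subalgebra 𝒜)
      (Set.singleton_subset_iff.2 ha) hx
  have hker (n : ℕ) : ∀ x : A, δ x = 0 →
      (∀ j : ℤ, j < 0 ∨ n ≤ j → (DirectSum.decompose 𝒜 x j : A) = 0) →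
        x ∈ Algebra.adjoin ℂ {v} := by
    induction n with
    | zero =>
      intro x _ hx
      have : x = 0 := by
        rw [← DirectSum.sum_support_decompose 𝒜 x]
        exact Finset.sum_eq_zero fun j _ ↦ hx j (by simpa using lt_or_ge j 0)
      exact this ▸ zero_mem _
    | succ n ih =>
      intro x hδx hx
      obtain ⟨c, q, hcq⟩ := exists_eq_algebraMap_mul_pow_of_mem_graded 𝒜 hd hdmin hvne hdiv
        (Dc m) hDv hD0 (Int.natCast_nonneg n) (DirectSum.decompose 𝒜 x n).2
        (htop hδx fun j hj ↦ hx j (.inr (by push_cast; omega)))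
      have hmem : (DirectSum.decompose 𝒜 x n : A) ∈ Algebra.adjoin ℂ {v} := by
        rw [hcq]
        exact mul_mem (algebraMap_mem _ c) (pow_mem (Algebra.self_mem_adjoin_singleton ℂ v) q)
      rw [← sub_add_cancel x (DirectSum.decompose 𝒜 x n : A)]
      refine add_mem (ih _ ?_ fun j hj ↦ ?_) hmem
      · rw [map_sub, hδx, hcq]
        simp [hδpow]
      · rw [DirectSum.decompose_sub, DirectSum.sub_apply, AddSubgroupClass.coe_sub]
        rcases eq_or_ne (n : ℤ) j with rfl | hnj
        · rw [DirectSum.decompose_of_mem_same 𝒜 (DirectSum.decompose 𝒜 x n).2, sub_self]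
        · rw [DirectSum.decompose_of_mem_ne 𝒜 (DirectSum.decompose 𝒜 x n).2 hnj,
            hx j (by push_cast; omega), sub_zero]
  refine ⟨fun x ↦ ?_, ?_⟩
  · rw [algebraMap_mem_adjoin_pair_inv_iff hvne]
    refine ⟨fun hx ↦ ?_, fun ⟨N, hN⟩ ↦ δ.eq_zero_of_mul_left (pow_ne_zero N hvne) (hδpow N)
      (δ.eqOn_adjoin (D2 := 0) (by simpa using hδv) hN)⟩
    obtain ⟨N, hN⟩ : ∃ N : ℕ, ∀ j, (DirectSum.decompose 𝒜 x j : A) ≠ 0 → -N ≤ j ∧ j < N := by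
      refine ⟨(DirectSum.decompose 𝒜 x).support.sup Int.natAbs + 1, fun j hj ↦ ?_⟩
      have := Finset.le_sup (f := Int.natAbs) (s := (DirectSum.decompose 𝒜 x).support) (b := j)
        (by simpa using hj)
      omega
    refine ⟨N, hker (N * d + N).toNat _ (by simp [hδpow, hx]) fun j hj ↦ ?_⟩
    have h := DirectSum.coe_decompose_mul_add_of_left_mem 𝒜 (SetLike.pow_mem_graded N hv) (b := x)
      (j := j - N • d)
    rw [add_sub_cancel] at h
    rw [h]
    refine mul_eq_zero_of_right _ (not_not.1 fun hne ↦ ?_)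
    have := hN _ hne
    have : (N : ℤ) ≤ N * d := le_mul_of_one_le_right (by positivity) hd
    rw [nsmul_eq_mul] at *
    omega
  · by_contra! h
    exact hδne (δ.eq_zero_of_graded_zero 𝒜 hd hv hvne hdiv hδv h)
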